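/- Let Γ ∈ M_ℓ(F_{q^s}) be a primitive m-th root of unity and C = QBCH_q(m, ℓ, δ, Γ). Define ψ : C → (M_ℓ(F_{q^s}))^m by sending (c₁,…,c_m) ∈ (F_q^ℓ)^m to the tuple of matrices whose first column is cᵢ^T and other columns are zero. Then ψ is an injective F_q-linear map preserving the ℓ-block weight, and its image is contained in the right Reed-Solomon code over the ring M_ℓ(F_{q^s}) with support (I, Γ, Γ², …, Γ^{m-1}) and dimension m - δ + 1, i.e., every ψ(c) is of the form ((I)f·, (Γ)f, …, (Γ^{m-1})f) for some f ∈ M_ℓ(F_{q^s})[X] of degree < m - δ + 1 (right evaluation). -/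

import Mathlib

open Matrix Polynomial

/-- The quasi-BCH code `QBCH_q(m, ℓ, δ, Γ)`. -/
def qbch {F K : Type*} [Field F] [Field K] [Algebra F K] (m ℓ δ : ℕ)
    (Γ : Matrix (Fin ℓ) (Fin ℓ) K) : Set (Fin m → Fin ℓ → F) :=
  {c | ∀ i : ℕ, 1 ≤ i → i ≤ δ - 1 →
    ∑ j : Fin m, (Γ ^ (i * (j : ℕ))) *ᵥ (fun r => algebraMap F K (c j r)) = 0}

/-- Right evaluation of a polynomial over a possibly noncommutative ring:
`(a)f = ∑ aⁱ fᵢ`. -/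
noncomputable def rightEval {A : Type*} [Semiring A] (f : Polynomial A) (a : A) : A :=
  f.sum fun e c => a ^ e * c

/-- The embedding `ψ` sending `(c₁,…,c_m) ∈ (F^ℓ)^m` to the tuple of matrices whose
first column is `cᵢ` and whose other columns are zero. -/
def psiMap {F K : Type*} [Field F] [Field K] [Algebra F K] {m ℓ : ℕ} [NeZero ℓ]
    (c : Fin m → Fin ℓ → F) : Fin m → Matrix (Fin ℓ) (Fin ℓ) K :=
  fun i => Matrix.of fun r s => if s = 0 then algebraMap F K (c i r) else 0

theorem natCast_ne_zero_of_isUnit_pow_sub_one {K A : Type*} [Field K] [Ring A] [Algebra K A]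
    [Nontrivial A] {γ : A} {m : ℕ} (hm : 0 < m) (hroot : γ ^ m = 1)
    (hprim : ∀ i : ℕ, 0 < i → i < m → IsUnit (γ ^ i - 1)) : (m : K) ≠ 0 := by
  intro h0
  obtain ⟨p, hchar⟩ := CharP.exists K
  have hdvd : p ∣ m := (CharP.cast_eq_zero_iff K p m).1 h0
  have hp0 : p ≠ 0 := by
    rintro rfl
    exact hm.ne' (Nat.eq_zero_of_zero_dvd hdvd)
  have hp : p.Prime := (CharP.char_is_prime_or_zero K p).resolve_right hp0
  have : Fact p.Prime := ⟨hp⟩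
  have : CharP A p := charP_of_injective_algebraMap (algebraMap K A).injective p
  obtain ⟨k, rfl⟩ := hdvd
  have hk : 0 < k := Nat.pos_of_mul_pos_left hm
  have hlt : k < p * k := lt_mul_of_one_lt_left hk hp.one_lt
  have hpow : (γ ^ k - 1) ^ p = 0 := by
    rw [sub_pow_char_of_commute _ (Commute.one_right _), ← pow_mul, mul_comm k p, hroot, one_pow,
      sub_self]
  exact not_isUnit_zero (hpow ▸ (hprim k hk hlt).pow p)

theorem sum_pow_mul_eq_zero_of_not_dvd {A : Type*} [Ring A] {γ : A} {m d : ℕ} (hm : 0 < m)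
    (hroot : γ ^ m = 1) (hprim : ∀ i : ℕ, 0 < i → i < m → IsUnit (γ ^ i - 1)) (hd : ¬ m ∣ d) :
    ∑ e ∈ Finset.range m, γ ^ (d * e) = 0 := by
  have hmod : γ ^ d = γ ^ (d % m) := pow_eq_pow_mod d hroot
  have hunit : IsUnit (γ ^ d - 1) := by
    rw [hmod]
    exact hprim _ (Nat.pos_of_ne_zero fun h => hd (Nat.dvd_of_mod_eq_zero h)) (Nat.mod_lt _ hm)
  refine (hunit.mul_right_eq_zero).1 ?_
  simp_rw [pow_mul]
  rw [mul_geom_sum, ← pow_mul, mul_comm d m, pow_mul, hroot, one_pow, sub_self]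

/-- Inverse discrete Fourier transform with respect to a primitive root of unity in a
possibly noncommutative algebra. -/
theorem sum_pow_mul_sum_pow_mul {A : Type*} [Ring A] {γ : A} {m : ℕ}
    (hroot : γ ^ m = 1) (hprim : ∀ i : ℕ, 0 < i → i < m → IsUnit (γ ^ i - 1))
    (a : Fin m → A) (i : Fin m) :
    ∑ e ∈ Finset.range m, (γ ^ (i : ℕ)) ^ e * ∑ j : Fin m, γ ^ ((m - e) * (j : ℕ)) * a j =
      m * a i := by
  have hm : 0 < m := i.pos
  have hexp : ∀ e ∈ Finset.range m, ∀ j : Fin m,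
      (γ ^ (i : ℕ)) ^ e * γ ^ ((m - e) * (j : ℕ)) = γ ^ ((i + (m - j)) * e) := by
    intro e he j
    have hadd : ∀ a b : ℕ, γ ^ (a + m * b) = γ ^ a := fun a b => by
      rw [pow_add, pow_mul, hroot, one_pow, mul_one]
    rw [← pow_mul, ← pow_add, ← hadd _ e, ← hadd ((i + (m - j)) * e) j]
    congr 1
    obtain ⟨u, hu⟩ := Nat.exists_eq_add_of_le (Finset.mem_range.1 he).le
    obtain ⟨v, hv⟩ := Nat.exists_eq_add_of_le j.isLt.le
    rw [show m - e = u by omega, show m - (j : ℕ) = v by omega]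
    zify at hu hv ⊢
    linear_combination (-(j : ℤ)) * hu + (e : ℤ) * hv
  have hsum : ∑ e ∈ Finset.range m, (γ ^ (i : ℕ)) ^ e *
      ∑ j : Fin m, γ ^ ((m - e) * (j : ℕ)) * a j =
      ∑ j : Fin m, (∑ e ∈ Finset.range m, γ ^ ((i + (m - j)) * e)) * a j := by
    simp_rw [Finset.sum_mul, Finset.mul_sum]
    rw [Finset.sum_comm]
    refine Finset.sum_congr rfl fun j _ => Finset.sum_congr rfl fun e he => ?_
    rw [← mul_assoc, hexp e he j]
  rw [hsum, Finset.sum_eq_single i]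
  · have hone : ∀ e, γ ^ (((i : ℕ) + (m - i)) * e) = 1 := fun e => by
      rw [Nat.add_sub_cancel' i.isLt.le, pow_mul, hroot, one_pow]
    simp only [hone, Finset.sum_const, Finset.card_range, nsmul_eq_mul, mul_one]
  · intro j _ hji
    rw [sum_pow_mul_eq_zero_of_not_dvd hm hroot hprim, zero_mul]
    rintro ⟨t, ht⟩
    have hne : (j : ℕ) ≠ i := fun h => hji (Fin.ext h)
    have hi := i.isLt
    have hj := j.isLt
    have ht0 : 0 < t := Nat.pos_of_ne_zero (by rintro rfl; omega)
    have ht2 : t < 2 := by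
      by_contra! h
      have := Nat.mul_le_mul_left m h
      omega
    obtain rfl : t = 1 := by omega
    omega
  · simp

theorem rightEval_sum_monomial {A : Type*} [Semiring A] (n : ℕ) (g : ℕ → A) (a : A) :
    rightEval (∑ e ∈ Finset.range n, monomial e (g e)) a = ∑ e ∈ Finset.range n, a ^ e * g e := by
  have hzero : ∀ e, a ^ e * (0 : A) = 0 := fun e => mul_zero _
  induction n with
  | zero => simp [rightEval]
  | succ n ih =>
    rw [Finset.sum_range_succ, Finset.sum_range_succ, ← ih]
    unfold rightEval
    rw [sum_add_index _ _ _ hzero fun _ _ _ => mul_add _ _ _, sum_monomial_index _ _ (hzero n)]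

theorem degree_sum_monomial_lt {A : Type*} [Semiring A] (n : ℕ) (g : ℕ → A) :
    (∑ e ∈ Finset.range n, monomial e (g e)).degree < (n : WithBot ℕ) := by
  rw [← mem_degreeLT]
  refine Submodule.sum_mem _ fun e he => mem_degreeLT.2 ?_
  exact (degree_monomial_le e _).trans_lt (by exact_mod_cast Finset.mem_range.1 he)

theorem psiMap_apply_eq_zero_iff {F K : Type*} [Field F] [Field K] [Algebra F K] {m ℓ : ℕ}
    [NeZero ℓ] (c : Fin m → Fin ℓ → F) (j : Fin m) : psiMap (K := K) c j = 0 ↔ c j = 0 := by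
  constructor
  · intro h
    ext r
    simpa [psiMap] using congrFun₂ h r 0
  · intro h
    ext r s
    simp [psiMap, h]

theorem psiMap_injective {F K : Type*} [Field F] [Field K] [Algebra F K] {m ℓ : ℕ} [NeZero ℓ] :
    Function.Injective (psiMap (F := F) (K := K) (m := m) (ℓ := ℓ)) := by
  intro c d h
  ext j r
  simpa [psiMap] using congrFun₂ (congrFun h j) r 0

theorem sum_mul_psiMap_eq_zero {F K : Type*} [Field F] [Field K] [Algebra F K] {m ℓ : ℕ}
    [NeZero ℓ] (M : Fin m → Matrix (Fin ℓ) (Fin ℓ) K) (c : Fin m → Fin ℓ → F)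
    (h : ∑ j, M j *ᵥ (fun r => algebraMap F K (c j r)) = 0) :
    ∑ j, M j * psiMap (K := K) c j = 0 := by
  ext r s
  have hr := congrFun h r
  by_cases hs : s = 0
  · simpa [psiMap, Matrix.sum_apply, Matrix.mul_apply, Matrix.mulVec, dotProduct, hs] using hr
  · simp [psiMap, Matrix.sum_apply, Matrix.mul_apply, hs]


/-- `ψ` is an injective `F_q`-linear map preserving the `ℓ`-block
weight, and it maps `C = QBCH_q(m,ℓ,δ,Γ)` into the right Reed–Solomon code over
`M_ℓ(F_{q^s})` with support `(I, Γ, …, Γ^{m-1})` and dimension `m - δ + 1`: every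
`ψ(c)` is `((I)f, (Γ)f, …, (Γ^{m-1})f)` for some `f` of degree `< m - δ + 1`
(right evaluation). -/
theorem stmt_18 {F K : Type*} [Field F] [Field K] [Algebra F K]
    [DecidableEq F] [DecidableEq K] {m ℓ δ : ℕ} [NeZero ℓ]
    (Γ : Matrix (Fin ℓ) (Fin ℓ) K)
    (hroot : Γ ^ m = 1)
    (hprim : ∀ i : ℕ, 0 < i → i < m → IsUnit (Γ ^ i - 1))
    (hδ2 : 2 ≤ δ) (hδm : δ ≤ m) :
    Function.Injective (psiMap (F := F) (K := K) (m := m) (ℓ := ℓ)) ∧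
    (∀ (a : F) (c : Fin m → Fin ℓ → F),
      psiMap (K := K) (a • c) = algebraMap F K a • psiMap (K := K) c) ∧
    (∀ c d : Fin m → Fin ℓ → F,
      psiMap (K := K) (c + d) = psiMap (K := K) c + psiMap (K := K) d) ∧
    (∀ c : Fin m → Fin ℓ → F,
      (Finset.univ.filter fun j : Fin m => psiMap (K := K) c j ≠ 0).card
        = (Finset.univ.filter fun j : Fin m => c j ≠ 0).card) ∧
    (∀ c ∈ qbch (F := F) m ℓ δ Γ,
      ∃ f : Polynomial (Matrix (Fin ℓ) (Fin ℓ) K),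
        f.degree < ((m - δ + 1 : ℕ) : WithBot ℕ) ∧
        ∀ i : Fin m, psiMap (K := K) c i = rightEval f (Γ ^ (i : ℕ))) := by
  refine ⟨psiMap_injective, ?_, ?_, ?_, ?_⟩
  · intro a c
    ext j r s
    simp [psiMap]
  · intro c d
    ext j r s
    by_cases hs : s = 0 <;> simp [psiMap, hs]
  · intro c
    simp only [ne_eq, psiMap_apply_eq_zero_iff]
  · intro c hc
    have hmK : (m : K) ≠ 0 := natCast_ne_zero_of_isUnit_pow_sub_one (by omega) hroot hprim
    let g : ℕ → Matrix (Fin ℓ) (Fin ℓ) K := fun e =>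
      ∑ j : Fin m, Γ ^ ((m - e) * (j : ℕ)) * psiMap (K := K) c j
    have hg : ∀ e ∈ Finset.range m, e ∉ Finset.range (m - δ + 1) → g e = 0 := by
      intro e he hne
      rw [Finset.mem_range] at he hne
      exact sum_mul_psiMap_eq_zero _ c (hc (m - e) (by omega) (by omega))
    refine ⟨∑ e ∈ Finset.range (m - δ + 1), monomial e ((m : K)⁻¹ • g e),
      degree_sum_monomial_lt _ _, fun i => ?_⟩
    rw [rightEval_sum_monomial]
    simp_rw [mul_smul_comm]
    rw [← Finset.smul_sum, Finset.sum_subset (Finset.range_mono (by omega : m - δ + 1 ≤ m))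
        fun e he hne => by rw [hg e he hne, mul_zero],
      sum_pow_mul_sum_pow_mul hroot hprim, ← nsmul_eq_mul, ← Nat.cast_smul_eq_nsmul K, smul_smul,
      inv_mul_cancel₀ hmK, one_smul]
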